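/- (Lemma 2: the star-to-clique conversion is irreversible.) Take the role set M = Fin 3 and the entity type N = Fin 2. Define, for a set T of instances (functions M → N), the star-to-clique image S2C(T) := {(t ρ, (ρ, ρ'), t ρ') | t ∈ T, ρ ρ' ∈ M, ρ ≠ ρ'} ⊆ N × (M × M) × N. Then the map T ↦ S2C(T) is not injective: there exist two distinct sets of instances T ≠ T' (subsets of M → N) with S2C(T) = S2C(T'). -/

import Mathlib

/-- Any two coordinates of a binary triple are shared with a triple of even parity. -/
theorem exists_even_agreeing_on_pair (t : Fin 3 → Fin 2) (ρ ρ' : Fin 3) (h : ρ ≠ ρ') :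
    ∃ t' : Fin 3 → Fin 2, t' 0 + t' 1 + t' 2 = 0 ∧ t' ρ = t ρ ∧ t' ρ' = t ρ' := by
  generalize t ρ = a, t ρ' = b
  revert ρ ρ' a b
  decide

/-- Lemma 2: the star-to-clique conversion is irreversible.  With role set `Fin 3`
and entity type `Fin 2`, the map sending a set `T` of instances to its
star-to-clique image `S2C(T) = {(t ρ, (ρ, ρ'), t ρ') | t ∈ T, ρ ≠ ρ'}` is not
injective. -/
theorem s2c_not_injective :
    ∃ T T' : Set (Fin 3 → Fin 2),
      T ≠ T' ∧
      {e : Fin 2 × (Fin 3 × Fin 3) × Fin 2 |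
          ∃ t ∈ T, ∃ ρ ρ' : Fin 3, ρ ≠ ρ' ∧ e = (t ρ, (ρ, ρ'), t ρ')}
        = {e : Fin 2 × (Fin 3 × Fin 3) × Fin 2 |
          ∃ t ∈ T', ∃ ρ ρ' : Fin 3, ρ ≠ ρ' ∧ e = (t ρ, (ρ, ρ'), t ρ')} := by
  refine ⟨{t | t 0 + t 1 + t 2 = 0}, Set.univ, ?_, Set.Subset.antisymm ?_ ?_⟩
  · intro h
    have h1 : (fun _ => 1 : Fin 3 → Fin 2) ∈ {t : Fin 3 → Fin 2 | t 0 + t 1 + t 2 = 0} :=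
      h ▸ Set.mem_univ _
    exact absurd h1 (by simp)
  · rintro e ⟨t, -, h⟩
    exact ⟨t, Set.mem_univ t, h⟩
  · rintro e ⟨t, -, ρ, ρ', hne, rfl⟩
    obtain ⟨t', ht', h, h'⟩ := exists_even_agreeing_on_pair t ρ ρ' hne
    exact ⟨t', ht', ρ, ρ', hne, by rw [h, h']⟩
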